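/- Let r \ge 1 and let a_1 \ge a_2 \ge \cdots \ge a_r \ge 0 be integers, and define p(d) = \binom{d+a_1}{a_1} + \binom{d+a_2-1}{a_2} + \cdots + \binom{d+a_r-(r-1)}{a_r}. Then for every integer R \ge r, one has p(R+1) = p(R)^{<R>}. -/

import Mathlib

/-- The value of a Macaulay representation whose entries are below `m` is less than `C(m, n)`. -/
theorem sum_choose_lt_of_strictMono (n m : ℕ) (k : Fin n → ℕ) (hk : StrictMono k)
    (hm : ∀ i, k i < m) : ∑ i : Fin n, (k i).choose (i.1 + 1) < m.choose n := by
  induction n generalizing m with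
  | zero => simp
  | succ n ih =>
    rw [Fin.sum_univ_castSucc]
    have hlt := ih (k (Fin.last n)) (fun i => k i.castSucc)
      (fun i j hij => hk (Fin.castSucc_lt_castSucc_iff.mpr hij))
      (fun i => hk (Fin.castSucc_lt_last i))
    have hle := Nat.choose_le_choose (n + 1) (Nat.succ_le_of_lt (hm (Fin.last n)))
    rw [Nat.succ_eq_add_one, Nat.choose_succ_succ'] at hle
    simp only [Fin.val_castSucc, Fin.val_last] at hlt ⊢
    omega

/-- If the top entry of one Macaulay representation is smaller than that of another, then so is
its value. -/
theorem sum_choose_lt_of_last_lt (n : ℕ) (k l : Fin (n + 1) → ℕ) (hk : StrictMono k)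
    (h : k (Fin.last n) < l (Fin.last n)) :
    ∑ i, (k i).choose (i.1 + 1) < ∑ i, (l i).choose (i.1 + 1) :=
  (sum_choose_lt_of_strictMono (n + 1) (l (Fin.last n)) k hk
    fun i => (hk.monotone (Fin.le_last i)).trans_lt h).trans_le
    (Finset.single_le_sum (f := fun i => (l i).choose (i.1 + 1))
      (fun _ _ => Nat.zero_le _) (Finset.mem_univ (Fin.last n)))

/-- Uniqueness of Macaulay representations. -/
theorem eq_of_sum_choose_eq (n : ℕ) (k l : Fin n → ℕ) (hk : StrictMono k) (hl : StrictMono l)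
    (h : ∑ i, (k i).choose (i.1 + 1) = ∑ i, (l i).choose (i.1 + 1)) : k = l := by
  induction n with
  | zero => exact Subsingleton.elim k l
  | succ n ih =>
    have hlast : k (Fin.last n) = l (Fin.last n) := by
      rcases lt_trichotomy (k (Fin.last n)) (l (Fin.last n)) with hlt | heq | hgt
      · exact absurd h (sum_choose_lt_of_last_lt n k l hk hlt).ne
      · exact heq
      · exact absurd h (sum_choose_lt_of_last_lt n l k hl hgt).ne'
    rw [Fin.sum_univ_castSucc, Fin.sum_univ_castSucc, hlast] at h
    have hinit := ih (fun i => k i.castSucc) (fun i => l i.castSucc)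
      (fun i j hij => hk (Fin.castSucc_lt_castSucc_iff.mpr hij))
      (fun i j hij => hl (Fin.castSucc_lt_castSucc_iff.mpr hij)) (Nat.add_right_cancel h)
    funext i
    exact Fin.lastCases hlast (congrFun hinit) i

/-- The entries of the `R`-th Macaulay representation of the Hilbert polynomial attached to `a`,
evaluated at `R`. -/
def macaulayEntries (r R : ℕ) (a : Fin r → ℕ) (j : Fin R) : ℕ :=
  if h : R - 1 - j.1 < r then j.1 + 1 + a ⟨R - 1 - j.1, h⟩ else j.1

theorem macaulayEntries_strictMono (r R : ℕ) (a : Fin r → ℕ) (ha : Antitone a) :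
    StrictMono (macaulayEntries r R a) := by
  intro i j hij
  have hlt : i.1 < j.1 := hij
  unfold macaulayEntries
  split_ifs with hi hj hj
  · have := ha (show (⟨R - 1 - j.1, hj⟩ : Fin r) ≤ ⟨R - 1 - i.1, hi⟩ from
      Fin.mk_le_mk.mpr (by omega))
    omega
  all_goals omega

/-- Shifting both arguments of the binomials by `t`, the Hilbert polynomial evaluated at `R + t`
is the sum over its Macaulay entries. -/
theorem sum_choose_eq_sum_macaulayEntries (r R t : ℕ) (hR : r ≤ R) (a : Fin r → ℕ) :
    ∑ i : Fin r, (R + t + a i - i.1).choose (a i)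
      = ∑ j : Fin R, (macaulayEntries r R a j + t).choose (j.1 + 1 + t) := by
  refine Fintype.sum_of_injective (fun i : Fin r => (⟨R - 1 - i.1, by omega⟩ : Fin R)) ?_ _ _ ?_ ?_
  · intro i j hij
    have := Fin.mk.inj_iff.mp hij
    exact Fin.ext (by omega)
  · intro j hj
    have hnot : ¬ R - 1 - j.1 < r := fun h =>
      hj ⟨⟨R - 1 - j.1, h⟩, Fin.ext (by simp only; omega)⟩
    rw [macaulayEntries, dif_neg hnot]
    exact Nat.choose_eq_zero_of_lt (by omega)
  · intro i
    have hi : R - 1 - (R - 1 - i.1) = i.1 := by omega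
    have hentry : macaulayEntries r R a ⟨R - 1 - i.1, by omega⟩ = R - i.1 + a i := by
      simp only [macaulayEntries, hi, i.2, dif_pos, Fin.eta]
      omega
    simp only [hentry]
    exact (Nat.choose_symm_of_eq_add (by omega)).trans
      (congrArg₂ Nat.choose (by omega) rfl)


/-- Let `r ≥ 1` and `a_1 ≥ a_2 ≥ ⋯ ≥ a_r ≥ 0` be integers, and let
`p(d) = C(d+a_1, a_1) + C(d+a_2-1, a_2) + ⋯ + C(d+a_r-(r-1), a_r)` be the associated Hilbert
polynomial (with Gotzmann number `r`).  Then for every `R ≥ r`, one has `p(R+1) = p(R)^{<R>}`,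
where `c^{<R>}` is computed from the `R`-th Macaulay representation
`c = C(k_R, R) + ⋯ + C(k_1, 1)` (`k_R > ⋯ > k_1 ≥ 0`) as
`c^{<R>} = C(k_R+1, R+1) + ⋯ + C(k_1+1, 2)`.  The Macaulay representation is encoded by a
strictly monotone `kseq : Fin R → ℕ` (with `kseq ⟨i,_⟩ = k_{i+1}`), and the tuple `a` by an
antitone `a : Fin r → ℕ` (with `a ⟨i,_⟩ = a_{i+1}`). -/
theorem hilbert_polynomial_growth (r : ℕ) (hr : 1 ≤ r) (a : Fin r → ℕ) (ha : Antitone a)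
    (R : ℕ) (hR : r ≤ R) (kseq : Fin R → ℕ) (hmono : StrictMono kseq)
    (hrep : ∑ i : Fin r, Nat.choose (R + a i - i.1) (a i)
      = ∑ i : Fin R, Nat.choose (kseq i) (i.1 + 1)) :
    ∑ i : Fin r, Nat.choose (R + 1 + a i - i.1) (a i)
      = ∑ i : Fin R, Nat.choose (kseq i + 1) (i.1 + 2) := by
  have hk : kseq = macaulayEntries r R a :=
    eq_of_sum_choose_eq R _ _ hmono (macaulayEntries_strictMono r R a ha)
      (hrep.symm.trans (sum_choose_eq_sum_macaulayEntries r R 0 hR a))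
  rw [hk]
  exact sum_choose_eq_sum_macaulayEntries r R 1 hR a
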